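/- In the multi-server secure aggregation model, assume only the structural and correctness constraints. For any u' ∈ [U], any 𝒰 ⊆ [U], and any subset 𝒯 ⊆ 𝒦 such that for every u ∈ 𝒰 ∖ {u'} there exists v' ∈ [V_u] with (u,v') ∉ 𝒯, it holds that H({Y_u}_{u∈𝒰} | {X_{u',v}}_{v∈[V_{u'}]}, {W_{i,j}, Z_{i,j}}_{(i,j)∈𝒯}) ≥ |𝒰 ∖ {u'}|·L. -/

import Mathlib

open Finset

open scoped Classical

noncomputable section

/-- Probability that the random variable `X` takes the value `s`, under the weights `μ`. -/
def prb {Ω : Type} [Fintype Ω] (μ : Ω → ℝ) {α : Type} (X : Ω → α) (s : α) : ℝ :=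
  ∑ ω ∈ Finset.univ.filter fun ω => X ω = s, μ ω

/-- Shannon entropy of `X` in `q`-ary units. -/
def ent (q : ℕ) {Ω : Type} [Fintype Ω] (μ : Ω → ℝ) {α : Type} [Fintype α] (X : Ω → α) : ℝ :=
  -∑ s : α, prb μ X s * Real.logb q (prb μ X s)

/-- Conditional entropy `H(X | Y)` in `q`-ary units. -/
def condEnt (q : ℕ) {Ω : Type} [Fintype Ω] (μ : Ω → ℝ) {α β : Type} [Fintype α] [Fintype β]
    (X : Ω → α) (Y : Ω → β) : ℝ :=
  ent q μ (fun ω => (X ω, Y ω)) - ent q μ Y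

/-- Conditional mutual information `I(X ; Y ∣ Z)` in `q`-ary units. -/
def mutInfo (q : ℕ) {Ω : Type} [Fintype Ω] (μ : Ω → ℝ) {α β γ : Type}
    [Fintype α] [Fintype β] [Fintype γ] (X : Ω → α) (Y : Ω → β) (Z : Ω → γ) : ℝ :=
  condEnt q μ X Z - condEnt q μ X fun ω => (Y ω, Z ω)

/-- The joint random variable formed by the members of a family of random variables
indexed by a finset. -/
def restr {Ω ι α : Type} (Z : ι → Ω → α) (T : Finset ι) : Ω → { i // i ∈ T } → α :=
  fun ω i => Z i.1 ω

/-- The set of users `𝒦`: user `⟨u,v⟩` is the `v`-th user of server `u`. -/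
abbrev Usr (U : ℕ) (V : Fin U → ℕ) : Type := Σ u : Fin U, Fin (V u)

/-- Total number of users, `K = ∑ u, V u`. -/
def Ktot (U : ℕ) (V : Fin U → ℕ) : ℕ := ∑ u, V u

/-- The users connected to server `u`, `𝒦_{{u}}`. -/
def Ksrv (U : ℕ) (V : Fin U → ℕ) (u : Fin U) : Finset (Usr U V) :=
  Finset.univ.filter fun i => i.1 = u

/-- The users connected to a set of servers, `𝒦_𝒰`. -/
def KsrvSet (U : ℕ) (V : Fin U → ℕ) (A : Finset (Fin U)) : Finset (Usr U V) :=
  Finset.univ.filter fun i => i.1 ∈ A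

/-- The set of servers `𝒰^{(m,n)}` associated with a security input set `Sm` and a
colluding set `Tn`. -/
def UServers (U : ℕ) (V : Fin U → ℕ) (Sm Tn : Finset (Usr U V)) : Finset (Fin U) :=
  Finset.univ.filter fun u =>
    (Sm ∩ Ksrv U V u).Nonempty ∧ ((Sm ∪ Tn) ∩ Ksrv U V u).card = V u

/-- The set `(𝒮_m ∩ 𝒦_{{u}}) ∪ 𝒦_{𝒰^{(m,n)}} ∪ 𝒯_n`. -/
def BigB (U : ℕ) (V : Fin U → ℕ) (Sm Tn : Finset (Usr U V)) (u : Fin U) : Finset (Usr U V) :=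
  (Sm ∩ Ksrv U V u) ∪ KsrvSet U V (UServers U V Sm Tn) ∪ Tn

/-- The implicit security input set `𝒮_I`. -/
def SImp (U : ℕ) (V : Fin U → ℕ) {M N : ℕ} (S : Fin M → Finset (Usr U V))
    (T : Fin N → Finset (Usr U V)) : Finset (Usr U V) :=
  Finset.univ.filter fun i =>
    (∀ m, i ∉ S m) ∧
    ∃ u m n, (BigB U V (S m) (T n) u).card = Ktot U V - 1 ∧ i ∉ BigB U V (S m) (T n) u

/-- The total security input set `𝒮̄`. -/
def Sbar (U : ℕ) (V : Fin U → ℕ) {M N : ℕ} (S : Fin M → Finset (Usr U V))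
    (T : Fin N → Finset (Usr U V)) : Finset (Usr U V) :=
  (Finset.univ.biUnion fun m => S m) ∪ SImp U V S T

/-- The set `𝒜_{u,m,n}`. -/
def Aset (U : ℕ) (V : Fin U → ℕ) {M N : ℕ} (S : Fin M → Finset (Usr U V))
    (T : Fin N → Finset (Usr U V)) (u : Fin U) (m : Fin M) (n : Fin N) : Finset (Usr U V) :=
  BigB U V (S m) (T n) u ∩ Sbar U V S T

/-- `a* = max_{u,m,n} |𝒜_{u,m,n}|`. -/
def aStar (U : ℕ) (V : Fin U → ℕ) {M N : ℕ} (S : Fin M → Finset (Usr U V))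
    (T : Fin N → Finset (Usr U V)) : ℕ :=
  Finset.univ.sup fun t : Fin U × Fin M × Fin N => (Aset U V S T t.1 t.2.1 t.2.2).card

/-- `|((𝒮_m ∩ 𝒦_{{u}}) ∪ 𝒯_n) ∩ 𝒮̄| + |𝒰^{(m,n)} ∖ {u}|`. -/
def eVal (U : ℕ) (V : Fin U → ℕ) {M N : ℕ} (S : Fin M → Finset (Usr U V))
    (T : Fin N → Finset (Usr U V)) (u : Fin U) (m : Fin M) (n : Fin N) : ℕ :=
  (((S m ∩ Ksrv U V u) ∪ T n) ∩ Sbar U V S T).card + ((UServers U V (S m) (T n)).erase u).card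

/-- `e* = max_{u,m,n} (|((𝒮_m ∩ 𝒦_{{u}}) ∪ 𝒯_n) ∩ 𝒮̄| + |𝒰^{(m,n)} ∖ {u}|)`. -/
def eStar (U : ℕ) (V : Fin U → ℕ) {M N : ℕ} (S : Fin M → Finset (Usr U V))
    (T : Fin N → Finset (Usr U V)) : ℕ :=
  Finset.univ.sup fun t : Fin U × Fin M × Fin N => eVal U V S T t.1 t.2.1 t.2.2

/-- The set `𝒬_1`. -/
def Q1set (U : ℕ) (V : Fin U → ℕ) {M N : ℕ} (S : Fin M → Finset (Usr U V))
    (T : Fin N → Finset (Usr U V)) : Finset (Usr U V) :=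
  (Finset.univ.filter fun t : Fin U × Fin M × Fin N =>
      (Aset U V S T t.1 t.2.1 t.2.2).card = (Sbar U V S T).card).biUnion
    fun t => BigB U V (S t.2.1) (T t.2.2) t.1

/-- The set `𝒬_2`. -/
def Q2set (U : ℕ) (V : Fin U → ℕ) {M N : ℕ} (S : Fin M → Finset (Usr U V))
    (T : Fin N → Finset (Usr U V)) : Finset (Usr U V) :=
  (Finset.univ.filter fun t : Fin U × Fin M × Fin N =>
      eVal U V S T t.1 t.2.1 t.2.2 = eStar U V S T).biUnion
    fun t => BigB U V (S t.2.1) (T t.2.2) t.1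

/-- The set `𝒬`. -/
def Qset (U : ℕ) (V : Fin U → ℕ) {M N : ℕ} (S : Fin M → Finset (Usr U V))
    (T : Fin N → Finset (Usr U V)) : Finset (Usr U V) :=
  if (Q1set U V S T).Nonempty then Q1set U V S T ∪ Q2set U V S T else ∅

/-- A secure-aggregation scheme: all structural, distributional, correctness and
security constraints of the multi-server secure aggregation model, with entropies in
`q`-ary units for `q = |F|`. -/
def IsScheme (U : ℕ) (V : Fin U → ℕ) (M N : ℕ) (S : Fin M → Finset (Usr U V))
    (T : Fin N → Finset (Usr U V)) (F : Type) [Field F] [Fintype F]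
    (Ω : Type) [Fintype Ω] (μ : Ω → ℝ) (L LX LY LZ LSig : ℕ)
    (W : Usr U V → Ω → Fin L → F) (Z : Usr U V → Ω → Fin LZ → F)
    (X : Usr U V → Ω → Fin LX → F) (Y : Fin U → Ω → Fin LY → F)
    (ZS : Ω → Fin LSig → F) : Prop :=
  let q := Fintype.card F
  (1 ≤ L) ∧
  (∀ ω, 0 ≤ μ ω) ∧ (∑ ω, μ ω = 1) ∧
  -- each input consists of `L` i.i.d. uniform `q`-ary symbols
  (∀ i, ent q μ (W i) = L) ∧
  -- the inputs are mutually independent of each other and of all keys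
  (ent q μ (fun ω => (restr W Finset.univ ω, restr Z Finset.univ ω)) =
    ent q μ (restr Z Finset.univ) + ∑ i, ent q μ (W i)) ∧
  -- the source key consists of `LSig` i.i.d. uniform `q`-ary symbols
  (ent q μ ZS = LSig) ∧
  -- the individual keys are deterministic functions of the source key
  (condEnt q μ (restr Z Finset.univ) ZS = 0) ∧
  -- each user message is a deterministic function of its input and key
  (∀ i, condEnt q μ (X i) (fun ω => (W i ω, Z i ω)) = 0) ∧
  -- each server message is a deterministic function of its received messages
  (∀ u, condEnt q μ (Y u) (restr X (Ksrv U V u)) = 0) ∧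
  -- correctness
  (∀ k, condEnt q μ (fun ω => ∑ i, W i ω)
    (fun ω => (restr Y (Finset.univ.erase k) ω, restr X (Ksrv U V k) ω)) = 0) ∧
  -- security
  (∀ k m n, mutInfo q μ
    (fun ω => (restr Y (Finset.univ.erase k) ω, restr X (Ksrv U V k) ω))
    (restr W (S m))
    (fun ω => (∑ i, W i ω, restr W (T n) ω, restr Z (T n) ω)) = 0)

/-- A rate tuple `(R_X, R_Y, R_{Z_Σ})` is achievable. -/
def Achievable (U : ℕ) (V : Fin U → ℕ) (M N : ℕ) (S : Fin M → Finset (Usr U V))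
    (T : Fin N → Finset (Usr U V)) (R : ℝ × ℝ × ℝ) : Prop :=
  ∃ (F : Type) (iF : Field F) (iFt : Fintype F) (Ω : Type) (iΩ : Fintype Ω)
    (μ : Ω → ℝ) (L LX LY LZ LSig : ℕ)
    (W : Usr U V → Ω → Fin L → F) (Z : Usr U V → Ω → Fin LZ → F)
    (X : Usr U V → Ω → Fin LX → F) (Y : Fin U → Ω → Fin LY → F)
    (ZS : Ω → Fin LSig → F),
    R.1 = (LX : ℝ) / (L : ℝ) ∧ R.2.1 = (LY : ℝ) / (L : ℝ) ∧ R.2.2 = (LSig : ℝ) / (L : ℝ) ∧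
    @IsScheme U V M N S T F iF iFt Ω iΩ μ L LX LY LZ LSig W Z X Y ZS

end

theorem restr_eq_iff {Ω ι α : Type} {Z : ι → Ω → α} {T : Finset ι} {ω₁ ω₂ : Ω} :
    restr Z T ω₁ = restr Z T ω₂ ↔ ∀ i ∈ T, Z i ω₁ = Z i ω₂ := by
  simp [restr, funext_iff]

section Entropy

variable {Ω : Type} [Fintype Ω] {μ : Ω → ℝ} {α β γ : Type} {q : ℕ}

/-- `Y` determines `X` on the support of the weights `μ`. -/
def Determines (μ : Ω → ℝ) (Y : Ω → β) (X : Ω → α) : Prop :=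
  ∀ ω₁ ω₂, μ ω₁ ≠ 0 → μ ω₂ ≠ 0 → Y ω₁ = Y ω₂ → X ω₁ = X ω₂

theorem prb_nonneg (hμ : ∀ ω, 0 ≤ μ ω) (X : Ω → α) (s : α) : 0 ≤ prb μ X s :=
  Finset.sum_nonneg fun ω _ => hμ ω

theorem sum_prb_mul [Fintype α] (X : Ω → α) (g : α → ℝ) :
    ∑ s, prb μ X s * g s = ∑ ω, μ ω * g (X ω) := by
  rw [← Finset.sum_fiberwise_of_maps_to (t := Finset.univ) (g := X) fun _ _ => Finset.mem_univ _]
  refine Finset.sum_congr rfl fun s _ => ?_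
  rw [prb, Finset.sum_mul]
  refine Finset.sum_congr rfl fun ω hω => ?_
  rw [(Finset.mem_filter.1 hω).2]

theorem sum_prb [Fintype α] (hμ1 : ∑ ω, μ ω = 1) (X : Ω → α) : ∑ s, prb μ X s = 1 := by
  simpa [hμ1] using sum_prb_mul (μ := μ) X fun _ => 1

theorem le_prb (hμ : ∀ ω, 0 ≤ μ ω) (X : Ω → α) (ω : Ω) : μ ω ≤ prb μ X (X ω) :=
  Finset.single_le_sum (f := μ) (fun ω _ => hμ ω) (by simp)

theorem prb_pos (hμ : ∀ ω, 0 ≤ μ ω) (X : Ω → α) {ω : Ω} (hω : μ ω ≠ 0) : 0 < prb μ X (X ω) :=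
  lt_of_lt_of_le (lt_of_le_of_ne (hμ ω) hω.symm) (le_prb hμ X ω)

theorem exists_of_prb_ne_zero {X : Ω → α} {s : α} (h : prb μ X s ≠ 0) :
    ∃ ω, μ ω ≠ 0 ∧ X ω = s := by
  obtain ⟨ω, hω, hne⟩ := Finset.exists_ne_zero_of_sum_ne_zero h
  exact ⟨ω, hne, (Finset.mem_filter.1 hω).2⟩

theorem sum_prb_pair_left [Fintype α] (X : Ω → α) (Y : Ω → β) (t : β) :
    ∑ s, prb μ (fun ω => (X ω, Y ω)) (s, t) = prb μ Y t := by
  simp only [prb]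
  rw [← Finset.sum_fiberwise_of_maps_to (s := Finset.univ.filter fun ω => Y ω = t)
    (t := Finset.univ) (g := X) fun _ _ => Finset.mem_univ _]
  refine Finset.sum_congr rfl fun s _ => Finset.sum_congr ?_ fun _ _ => rfl
  ext ω
  simp [and_comm]

theorem ent_eq_sum [Fintype α] (X : Ω → α) :
    ent q μ X = -∑ ω, μ ω * Real.logb q (prb μ X (X ω)) := by
  rw [ent, sum_prb_mul X fun s => Real.logb q (prb μ X s)]

theorem Determines.prb_le (hμ : ∀ ω, 0 ≤ μ ω) {X : Ω → α} {Y : Ω → β} (h : Determines μ Y X)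
    {ω : Ω} (hω : μ ω ≠ 0) : prb μ Y (Y ω) ≤ prb μ X (X ω) := by
  simp only [prb, Finset.sum_filter]
  refine Finset.sum_le_sum fun ω' _ => ?_
  by_cases h0 : μ ω' = 0
  · simp [h0]
  · split_ifs with h1 h2 h2
    · exact le_rfl
    · exact absurd (h ω' ω h0 hω h1) h2
    · exact hμ ω'
    · exact le_rfl

theorem Determines.ent_le [Fintype α] [Fintype β] (hq : 1 < q) (hμ : ∀ ω, 0 ≤ μ ω) {X : Ω → α}
    {Y : Ω → β} (h : Determines μ Y X) : ent q μ X ≤ ent q μ Y := by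
  rw [ent_eq_sum, ent_eq_sum, neg_le_neg_iff]
  refine Finset.sum_le_sum fun ω _ => ?_
  by_cases hω : μ ω = 0
  · simp [hω]
  · exact mul_le_mul_of_nonneg_left (Real.logb_le_logb_of_le (by exact_mod_cast hq)
      (prb_pos hμ Y hω) (h.prb_le hμ hω)) (hμ ω)

theorem determines_of_condEnt_eq_zero [Fintype α] [Fintype β] (hq : 1 < q) (hμ : ∀ ω, 0 ≤ μ ω)
    {X : Ω → α} {Y : Ω → β} (h : condEnt q μ X Y = 0) : Determines μ Y X := by
  have hq' : (1 : ℝ) < q := by exact_mod_cast hq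
  have hdet : Determines μ (fun ω => (X ω, Y ω)) Y := fun _ _ _ _ e => (Prod.ext_iff.1 e).2
  have hle : ∀ ω ∈ (Finset.univ : Finset Ω), μ ω * Real.logb q (prb μ (fun ω => (X ω, Y ω))
      (X ω, Y ω)) ≤ μ ω * Real.logb q (prb μ Y (Y ω)) := fun ω _ => by
    by_cases hω : μ ω = 0
    · simp [hω]
    · exact mul_le_mul_of_nonneg_left (Real.logb_le_logb_of_le hq'
        (prb_pos hμ (fun ω => (X ω, Y ω)) hω) (hdet.prb_le hμ hω)) (hμ ω)
  rw [condEnt, ent_eq_sum, ent_eq_sum] at h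
  have heq := (Finset.sum_eq_sum_iff_of_le hle).1 (by linarith)
  intro ω₁ ω₂ h₁ h₂ hYY
  by_contra hne
  have hp : prb μ (fun ω => (X ω, Y ω)) (X ω₁, Y ω₁) = prb μ Y (Y ω₁) :=
    Real.logb_injOn_pos hq' (prb_pos hμ (fun ω => (X ω, Y ω)) h₁) (prb_pos hμ Y h₁)
      (mul_left_cancel₀ h₁ (heq ω₁ (Finset.mem_univ _)))
  refine absurd hp (ne_of_lt ?_)
  refine Finset.sum_lt_sum_of_subset (fun ω hω => ?_) (i := ω₂) (by simp [hYY])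
    (by simp [Ne.symm hne]) (lt_of_le_of_ne (hμ ω₂) h₂.symm) fun ω _ _ => hμ ω
  simp only [Finset.mem_filter, Prod.mk.injEq] at hω ⊢
  exact ⟨hω.1, hω.2.2⟩

theorem mul_log_sub_mul_log_le {p r : ℝ} (hp : 0 ≤ p) (hr : 0 ≤ r) (hpr : p ≠ 0 → r ≠ 0) :
    p * Real.log r - p * Real.log p ≤ r - p := by
  rcases hp.eq_or_lt with rfl | hp
  · simpa using hr
  · have hr' : 0 < r := lt_of_le_of_ne hr (hpr hp.ne').symm
    have h := mul_le_mul_of_nonneg_left (Real.log_le_sub_one_of_pos (div_pos hr' hp)) hp.le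
    rw [Real.log_div hr'.ne' hp.ne', mul_sub, mul_sub, mul_div_cancel₀ _ hp.ne'] at h
    linarith

/-- Gibbs' inequality. -/
theorem ent_le_of_sum_le_one [Fintype α] (hq : 1 < q) (hμ : ∀ ω, 0 ≤ μ ω) (hμ1 : ∑ ω, μ ω = 1)
    (X : Ω → α) {r : α → ℝ} (hr : ∀ s, 0 ≤ r s) (hpr : ∀ s, prb μ X s ≠ 0 → r s ≠ 0)
    (hr1 : ∑ s, r s ≤ 1) :
    ent q μ X ≤ -∑ ω, μ ω * Real.logb q (r (X ω)) ∧
      (ent q μ X = -∑ ω, μ ω * Real.logb q (r (X ω)) → ∀ s, r s ≠ 0 → prb μ X s ≠ 0) := by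
  have hlog : 0 < Real.log q := Real.log_pos (by exact_mod_cast hq)
  have hterm : ∀ s ∈ (Finset.univ : Finset α),
      prb μ X s * Real.log (r s) - prb μ X s * Real.log (prb μ X s) ≤ r s - prb μ X s :=
    fun s _ => mul_log_sub_mul_log_le (prb_nonneg hμ X s) (hr s) (hpr s)
  have hdiff : ent q μ X - -∑ ω, μ ω * Real.logb q (r (X ω)) =
      (∑ s, (prb μ X s * Real.log (r s) - prb μ X s * Real.log (prb μ X s))) / Real.log q := by
    rw [← sum_prb_mul X fun s => Real.logb q (r s), ent, Finset.sum_sub_distrib, sub_div,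
      Finset.sum_div, Finset.sum_div]
    simp only [Real.logb, mul_div_assoc]
    ring
  have hsum : ∑ s, (r s - prb μ X s) ≤ 0 := by
    rw [Finset.sum_sub_distrib, sum_prb hμ1 X]
    linarith
  have hle := Finset.sum_le_sum hterm
  refine ⟨?_, fun heq s hrs hps => ?_⟩
  · have := div_nonpos_of_nonpos_of_nonneg (hle.trans hsum) hlog.le
    linarith
  · rw [sub_eq_zero.2 heq, eq_comm, div_eq_zero_iff, or_iff_left hlog.ne'] at hdiff
    have := (Finset.sum_eq_sum_iff_of_le hterm).1 (by linarith) s (Finset.mem_univ _)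
    simp only [hps, zero_mul, sub_zero] at this
    exact hrs this.symm

/-- Submodularity of entropy. -/
theorem ent_submodular [Fintype α] [Fintype β] [Fintype γ] (hq : 1 < q) (hμ : ∀ ω, 0 ≤ μ ω)
    (hμ1 : ∑ ω, μ ω = 1) (X : Ω → α) (Y : Ω → β) (Z : Ω → γ) :
    ent q μ (fun ω => (X ω, Y ω, Z ω)) + ent q μ Z ≤
      ent q μ (fun ω => (X ω, Z ω)) + ent q μ (fun ω => (Y ω, Z ω)) := by
  set XZ : Ω → α × γ := fun ω => (X ω, Z ω)
  set YZ : Ω → β × γ := fun ω => (Y ω, Z ω)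
  have hr1 : ∑ s : α × β × γ,
      prb μ XZ (s.1, s.2.2) * prb μ YZ (s.2.1, s.2.2) / prb μ Z s.2.2 = 1 := by
    calc _ = ∑ t, ∑ x, ∑ y, prb μ XZ (x, t) * prb μ YZ (y, t) / prb μ Z t := by
          simp only [Fintype.sum_prod_type]
          rw [Finset.sum_comm' (s' := fun _ => Finset.univ) (t' := Finset.univ) (by simp),
            Finset.sum_congr rfl fun y _ => Finset.sum_comm]
          rw [Finset.sum_comm]
          exact Finset.sum_congr rfl fun t _ => Finset.sum_comm
      _ = ∑ t, prb μ Z t := by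
          refine Finset.sum_congr rfl fun t _ => ?_
          simp only [← Finset.sum_div, ← Finset.mul_sum, ← Finset.sum_mul]
          rw [sum_prb_pair_left, sum_prb_pair_left, mul_self_div_self]
      _ = 1 := sum_prb hμ1 Z
  have h := (ent_le_of_sum_le_one hq hμ hμ1 (fun ω => (X ω, Y ω, Z ω))
    (r := fun s => prb μ XZ (s.1, s.2.2) * prb μ YZ (s.2.1, s.2.2) / prb μ Z s.2.2)
    (fun s => div_nonneg (mul_nonneg (prb_nonneg hμ _ _) (prb_nonneg hμ _ _)) (prb_nonneg hμ _ _))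
    (fun s hs => by
      obtain ⟨ω, hω, rfl⟩ := exists_of_prb_ne_zero hs
      exact (div_pos (mul_pos (prb_pos hμ XZ hω) (prb_pos hμ YZ hω)) (prb_pos hμ Z hω)).ne')
    hr1.le).1
  have hsplit : ∑ ω, μ ω * Real.logb q (prb μ XZ (X ω, Z ω) * prb μ YZ (Y ω, Z ω) /
      prb μ Z (Z ω)) = ∑ ω, μ ω * Real.logb q (prb μ XZ (XZ ω)) +
      ∑ ω, μ ω * Real.logb q (prb μ YZ (YZ ω)) - ∑ ω, μ ω * Real.logb q (prb μ Z (Z ω)) := by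
    rw [← Finset.sum_add_distrib, ← Finset.sum_sub_distrib]
    refine Finset.sum_congr rfl fun ω _ => ?_
    by_cases hω : μ ω = 0
    · simp [hω]
    · have hx : prb μ XZ (X ω, Z ω) ≠ 0 := (prb_pos hμ XZ hω).ne'
      have hy : prb μ YZ (Y ω, Z ω) ≠ 0 := (prb_pos hμ YZ hω).ne'
      rw [Real.logb_div (mul_ne_zero hx hy) (prb_pos hμ Z hω).ne', Real.logb_mul hx hy]
      ring
  simp only [hsplit] at h
  rw [ent_eq_sum Z, ent_eq_sum XZ, ent_eq_sum YZ]
  linarith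

/-- Conditioning on more variables does not increase entropy. -/
theorem Determines.condEnt_le [Fintype α] [Fintype β] [Fintype γ] (hq : 1 < q)
    (hμ : ∀ ω, 0 ≤ μ ω) (hμ1 : ∑ ω, μ ω = 1) (X : Ω → α) {Y : Ω → β} {Z : Ω → γ}
    (h : Determines μ Y Z) : condEnt q μ X Y ≤ condEnt q μ X Z := by
  have h₁ := ent_submodular hq hμ hμ1 X Y Z
  have h₂ : ent q μ (fun ω => (X ω, Y ω)) ≤ ent q μ fun ω => (X ω, Y ω, Z ω) :=
    Determines.ent_le hq hμ fun _ _ _ _ e => by simp_all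
  have h₃ : ent q μ (fun ω => (Y ω, Z ω)) ≤ ent q μ Y :=
    Determines.ent_le hq hμ fun ω₁ ω₂ k₁ k₂ e => Prod.ext e (h ω₁ ω₂ k₁ k₂ e)
  simp only [condEnt]
  linarith

/-- The joint entropy of `X` and `Z` exceeds that of `Z` by at most the logarithm of the size of
the alphabet of `X`; in the case of equality `(X, Z)` has full support over that of `Z`. -/
theorem ent_pair_le [Fintype α] [Nonempty α] [Fintype γ] (hq : 1 < q)
    (hμ : ∀ ω, 0 ≤ μ ω) (hμ1 : ∑ ω, μ ω = 1) (X : Ω → α) (Z : Ω → γ) :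
    ent q μ (fun ω => (X ω, Z ω)) ≤ ent q μ Z + Real.logb q (Fintype.card α) ∧
      (ent q μ (fun ω => (X ω, Z ω)) = ent q μ Z + Real.logb q (Fintype.card α) →
        ∀ x ω, μ ω ≠ 0 → ∃ ω', μ ω' ≠ 0 ∧ X ω' = x ∧ Z ω' = Z ω) := by
  have hc : (Fintype.card α : ℝ) ≠ 0 := by exact_mod_cast Fintype.card_ne_zero
  have hr1 : ∑ s : α × γ, prb μ Z s.2 / Fintype.card α = 1 := by
    rw [Fintype.sum_prod_type]
    simp only [← Finset.sum_div, sum_prb hμ1 Z]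
    simp [hc]
  have hG := ent_le_of_sum_le_one hq hμ hμ1 (fun ω => (X ω, Z ω))
    (r := fun s => prb μ Z s.2 / Fintype.card α)
    (fun s => div_nonneg (prb_nonneg hμ _ _) (Nat.cast_nonneg _))
    (fun s hs => by
      obtain ⟨ω, hω, rfl⟩ := exists_of_prb_ne_zero hs
      exact div_ne_zero (prb_pos hμ Z hω).ne' hc) hr1.le
  have hsplit : -∑ ω, μ ω * Real.logb q (prb μ Z (Z ω) / Fintype.card α) =
      ent q μ Z + Real.logb q (Fintype.card α) := by
    have : ∀ ω, μ ω * Real.logb q (prb μ Z (Z ω) / Fintype.card α) =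
        μ ω * Real.logb q (prb μ Z (Z ω)) - μ ω * Real.logb q (Fintype.card α) := fun ω => by
      by_cases hω : μ ω = 0
      · simp [hω]
      · rw [Real.logb_div (prb_pos hμ Z hω).ne' hc, mul_sub]
    simp only [this, Finset.sum_sub_distrib, ← Finset.sum_mul, hμ1, ent_eq_sum Z]
    ring
  simp only [hsplit] at hG
  refine ⟨hG.1, fun heq x ω hω => ?_⟩
  obtain ⟨ω', hω', e⟩ := exists_of_prb_ne_zero
    (hG.2 heq (x, Z ω) (div_ne_zero (prb_pos hμ Z hω).ne' hc))
  exact ⟨ω', hω', (Prod.ext_iff.1 e).1, (Prod.ext_iff.1 e).2⟩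

theorem logb_card_blocks (F ι : Type) [Fintype F] [Fintype ι] [DecidableEq ι]
    (hF : 1 < Fintype.card F) (L : ℕ) :
    Real.logb (Fintype.card F) (Fintype.card (ι → Fin L → F)) = Fintype.card ι * L := by
  have h : (1 : ℝ) < Fintype.card F := by exact_mod_cast hF
  rw [Fintype.card_fun, Fintype.card_fun, Fintype.card_fin, ← pow_mul]
  push_cast
  rw [← Real.rpow_natCast, Real.logb_rpow (by linarith) h.ne']
  push_cast
  ring

end Entropy

theorem stmt10_lemma3_Y
    (U : ℕ) (hU : 3 ≤ U) (V : Fin U → ℕ) (hV : ∀ u, 1 ≤ V u)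
    (F : Type) [Field F] [Fintype F] (Ω : Type) [Fintype Ω] (μ : Ω → ℝ)
    (hμ0 : ∀ ω, 0 ≤ μ ω) (hμ1 : ∑ ω, μ ω = 1)
    (L LX LY LZ : ℕ) (hL : 1 ≤ L)
    (W : Usr U V → Ω → Fin L → F) (Z : Usr U V → Ω → Fin LZ → F)
    (X : Usr U V → Ω → Fin LX → F) (Y : Fin U → Ω → Fin LY → F)
    (hWent : ∀ i, ent (Fintype.card F) μ (W i) = L)
    (hInd : ent (Fintype.card F) μ (fun ω => (restr W Finset.univ ω, restr Z Finset.univ ω)) =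
      ent (Fintype.card F) μ (restr Z Finset.univ) + ∑ i, ent (Fintype.card F) μ (W i))
    (hX : ∀ i, condEnt (Fintype.card F) μ (X i) (fun ω => (W i ω, Z i ω)) = 0)
    (hY : ∀ u, condEnt (Fintype.card F) μ (Y u) (restr X (Ksrv U V u)) = 0)
    (hCorr : ∀ k, condEnt (Fintype.card F) μ (fun ω => ∑ i, W i ω)
      (fun ω => (restr Y (Finset.univ.erase k) ω, restr X (Ksrv U V k) ω)) = 0) :
    ∀ (u' : Fin U) (Us : Finset (Fin U)) (Tc : Finset (Usr U V)),
      (∀ u ∈ Us, u ≠ u' → ∃ v' : Fin (V u), (⟨u, v'⟩ : Usr U V) ∉ Tc) →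
      ((Us.erase u').card : ℝ) * L ≤ condEnt (Fintype.card F) μ
        (restr Y Us)
        (fun ω => (restr X (Ksrv U V u') ω, restr W Tc ω, restr Z Tc ω)) := by
  intro u' Us Tc hTc
  have hq : 1 < Fintype.card F := Fintype.one_lt_card
  choose g hg using show ∀ u, ∃ i : Usr U V, u ∈ Us.erase u' → i.1 = u ∧ i ∉ Tc from fun u => by
    by_cases hu : u ∈ Us.erase u'
    · obtain ⟨v, hv⟩ := hTc u (Finset.mem_of_mem_erase hu) (Finset.ne_of_mem_erase hu)
      exact ⟨⟨u, v⟩, fun _ => ⟨rfl, hv⟩⟩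
    · exact ⟨⟨u, ⟨0, hV u⟩⟩, fun h => absurd h hu⟩
  set J := (Us.erase u').image g
  have hJcard : J.card = (Us.erase u').card :=
    Finset.card_image_of_injOn fun a ha b hb e => by
      rw [← (hg a ha).1, ← (hg b hb).1, e]
  have hJmem : ∀ i ∈ J, i.1 ∈ Us.erase u' ∧ g i.1 = i ∧ i ∉ Tc := fun i hi => by
    obtain ⟨u, hu, rfl⟩ := Finset.mem_image.1 hi
    rw [(hg u hu).1]
    exact ⟨hu, rfl, (hg u hu).2⟩
  have hXd : ∀ i ω₁ ω₂, μ ω₁ ≠ 0 → μ ω₂ ≠ 0 → W i ω₁ = W i ω₂ → Z i ω₁ = Z i ω₂ →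
      X i ω₁ = X i ω₂ := fun i ω₁ ω₂ h₁ h₂ hw hz =>
    determines_of_condEnt_eq_zero hq hμ0 (hX i) ω₁ ω₂ h₁ h₂ (Prod.ext hw hz)
  have hYd : ∀ u ω₁ ω₂, μ ω₁ ≠ 0 → μ ω₂ ≠ 0 → (∀ i, i.1 = u → X i ω₁ = X i ω₂) →
      Y u ω₁ = Y u ω₂ := fun u ω₁ ω₂ h₁ h₂ hx =>
    determines_of_condEnt_eq_zero hq hμ0 (hY u) ω₁ ω₂ h₁ h₂
      (restr_eq_iff.2 fun i hi => hx i (Finset.mem_filter.1 hi).2)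
  have hSupp := (ent_pair_le hq hμ0 hμ1 (restr W Finset.univ) (restr Z Finset.univ)).2 (by
    rw [hInd, logb_card_blocks F _ hq]
    simp [hWent])
  set E := fun ω => (restr W Jᶜ ω, restr Z Finset.univ ω) with hE
  have hEB : Determines μ E fun ω => (restr X (Ksrv U V u') ω, restr W Tc ω, restr Z Tc ω) := by
    intro ω₁ ω₂ h₁ h₂ e
    obtain ⟨hw, hz⟩ := Prod.ext_iff.1 e
    simp only [hE, restr_eq_iff, Finset.mem_compl] at hw hz
    have hz' := fun i => hz i (Finset.mem_univ i)
    refine Prod.ext (restr_eq_iff.2 fun i hi => hXd i ω₁ ω₂ h₁ h₂ (hw i fun hiJ => ?_) (hz' i))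
      (Prod.ext (restr_eq_iff.2 fun i hi => hw i fun hiJ => (hJmem i hiJ).2.2 hi)
        (restr_eq_iff.2 fun i _ => hz' i))
    exact Finset.ne_of_mem_erase (hJmem i hiJ).1 (Finset.mem_filter.1 hi).2
  have hDet : Determines μ (fun ω => (restr Y Us ω, E ω))
      fun ω => (restr W Finset.univ ω, restr Z Finset.univ ω) := by
    intro ω₁ ω₂ h₁ h₂ e
    obtain ⟨hy, e'⟩ := Prod.ext_iff.1 e
    obtain ⟨hw, hzz⟩ := Prod.ext_iff.1 e'
    simp only [hE, restr_eq_iff, Finset.mem_compl] at hy hw hzz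
    have hz := fun i => hzz i (Finset.mem_univ i)
    refine Prod.ext (restr_eq_iff.2 fun i _ => ?_) (restr_eq_iff.2 hzz)
    by_cases hi : i ∈ J
    swap
    · exact hw i hi
    obtain ⟨hiU, hgi, -⟩ := hJmem i hi
    -- change only the `i`-th input of `ω₁` to that of `ω₂`
    obtain ⟨ω₃, h₃, hW₃, hZ₃⟩ := hSupp
      (fun j => if j.1 = i then W i ω₂ else W j.1 ω₁) ω₁ h₁
    have hw₃ : ∀ j, W j ω₃ = if j = i then W i ω₂ else W j ω₁ := fun j =>
      congrFun hW₃ ⟨j, Finset.mem_univ j⟩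
    have hz₃ : ∀ j, Z j ω₃ = Z j ω₁ := fun j => restr_eq_iff.1 hZ₃ j (Finset.mem_univ j)
    have hx₃₁ : ∀ j, j ≠ i → X j ω₃ = X j ω₁ := fun j hj =>
      hXd j ω₃ ω₁ h₃ h₁ (by rw [hw₃, if_neg hj]) (hz₃ j)
    have hx₃₂ : ∀ j, j.1 = i.1 → X j ω₃ = X j ω₂ := fun j hj => by
      refine hXd j ω₃ ω₂ h₃ h₂ ?_ ((hz₃ j).trans (hz j))
      rw [hw₃]
      split_ifs with hji
      · rw [hji]
      · refine hw j fun hjJ => hji ?_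
        rw [← (hJmem j hjJ).2.1, hj, hgi]
    have hy₃ : ∀ u, Y u ω₃ = Y u ω₁ := fun u => by
      by_cases hu : u = i.1
      · rw [hu, hYd i.1 ω₃ ω₂ h₃ h₂ hx₃₂, hy i.1 (Finset.mem_of_mem_erase hiU)]
      · exact hYd u ω₃ ω₁ h₃ h₁ fun j hj => hx₃₁ j fun hji => hu (by rw [← hj, hji])
    have hsum : ∑ j, W j ω₃ = ∑ j, W j ω₁ :=
      determines_of_condEnt_eq_zero hq hμ0 (hCorr u') ω₃ ω₁ h₃ h₁
        (Prod.ext (restr_eq_iff.2 fun u _ => hy₃ u) (restr_eq_iff.2 fun j hj => hx₃₁ j fun hji =>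
          Finset.ne_of_mem_erase hiU (by rw [← hji]; exact (Finset.mem_filter.1 hj).2)))
    rw [← Finset.add_sum_erase _ _ (Finset.mem_univ i),
      ← Finset.add_sum_erase (a := i) _ (fun j => W j ω₁) (Finset.mem_univ i),
      Finset.sum_congr rfl fun j hj => (hw₃ j).trans (if_neg (Finset.ne_of_mem_erase hj)),
      hw₃ i, if_pos rfl] at hsum
    exact (add_right_cancel hsum).symm
  have hfull := Determines.ent_le hq hμ0 hDet
  have hEle := (ent_pair_le hq hμ0 hμ1 (restr W Jᶜ) (restr Z Finset.univ)).1
  rw [logb_card_blocks F _ hq, Fintype.card_coe, Finset.card_compl,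
    Nat.cast_sub (Finset.card_le_univ J), hJcard] at hEle
  refine le_trans ?_ (hEB.condEnt_le hq hμ0 hμ1 (restr Y Us))
  simp only [hInd, hWent, Finset.sum_const, Finset.card_univ, nsmul_eq_mul] at hfull
  simp only [condEnt]
  linarith
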